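/- For every real θ, the operator R = R_II(θ) on V^{⊗3}, V = ℂ², is a unitary matrix and is a generalized Yang-Baxter operator of type (2,3,1): it is invertible, satisfies (R⊗Id_V)∘(Id_V⊗R)∘(R⊗Id_V) = (Id_V⊗R)∘(R⊗Id_V)∘(Id_V⊗R) on V^{⊗4}, and satisfies far-commutativity (R⊗Id_V^{⊗(j−2)})∘(Id_V^{⊗(j−2)}⊗R) = (Id_V^{⊗(j−2)}⊗R)∘(R⊗Id_V^{⊗(j−2)}) for all j ≥ 4. -/

import Mathlib

open scoped BigOperators
open Matrix

/-- Endomorphisms of `V^{⊗n}`, `dim V = d`, as multi-indexed matrices. -/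
abbrev MIM (d n : ℕ) := Matrix (Fin n → Fin d) (Fin n → Fin d) ℂ

/-- Kronecker (tensor) product of multi-indexed matrices. -/
noncomputable def mtens {d a b : ℕ} (f : MIM d a) (g : MIM d b) : MIM d (a + b) :=
  fun i j =>
    f (fun x => i (Fin.castAdd b x)) (fun x => j (Fin.castAdd b x)) *
    g (fun x => i (Fin.natAdd a x)) (fun x => j (Fin.natAdd a x))

/-- Partial operator trace `Sp_{p+m,m}` over the last `m` tensor factors. -/
noncomputable def pTr {d : ℕ} (p m : ℕ) (f : MIM d (p + m)) : MIM d p :=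
  fun i j => ∑ l : Fin m → Fin d, f (Fin.append i l) (Fin.append j l)

/-- Kronecker power `μ^{⊗ n}`. -/
noncomputable def mpow {d : ℕ} (μ : Matrix (Fin d) (Fin d) ℂ) (n : ℕ) : MIM d n :=
  fun i j => ∏ x : Fin n, μ (i x) (j x)

/-- Transport a multi-indexed matrix along an equality of the number of factors. -/
noncomputable def recast {d a b : ℕ} (h : a = b) (f : MIM d a) : MIM d b :=
  Matrix.reindex (Equiv.arrowCongr (finCongr h) (Equiv.refl (Fin d)))
    (Equiv.arrowCongr (finCongr h) (Equiv.refl (Fin d))) f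

/-- `R_i = I_m^{⊗(i-1)} ⊗ R ⊗ I_m^{⊗(n-i-1)}` acting on `V^{⊗(k+m(n-2))}`
(zero-based index `i : Fin (n-1)`). -/
noncomputable def Rop (d k m n : ℕ) (R : MIM d k) (i : Fin (n - 1)) : MIM d (k + m * (n - 2)) :=
  fun a b =>
    if ∀ x : Fin (k + m * (n - 2)),
        ((x : ℕ) < m * (i : ℕ) ∨ m * (i : ℕ) + k ≤ (x : ℕ)) → a x = b x then
      R (fun y => a ⟨m * (i : ℕ) + (y : ℕ), by
            have h1 : (i : ℕ) < n - 1 := i.isLt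
            have h2 : m * (i : ℕ) ≤ m * (n - 2) := Nat.mul_le_mul_left m (by omega)
            have h3 := y.isLt
            omega⟩)
        (fun y => b ⟨m * (i : ℕ) + (y : ℕ), by
            have h1 : (i : ℕ) < n - 1 := i.isLt
            have h2 : m * (i : ℕ) ≤ m * (n - 2) := Nat.mul_le_mul_left m (by omega)
            have h3 := y.isLt
            omega⟩)
    else 0

/-- `R` is a generalized Yang–Baxter operator of type `(d,k,m)`. -/
def IsGYB (d k m : ℕ) (R : MIM d k) : Prop :=
  IsUnit R ∧
  (Rop d k m 3 R 0 * Rop d k m 3 R 1 * Rop d k m 3 R 0 =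
      Rop d k m 3 R 1 * Rop d k m 3 R 0 * Rop d k m 3 R 1) ∧
  ∀ j : ℕ, (hj : 4 ≤ j) →
    Rop d k m j R ⟨0, by omega⟩ * Rop d k m j R ⟨j - 2, by omega⟩ =
      Rop d k m j R ⟨j - 2, by omega⟩ * Rop d k m j R ⟨0, by omega⟩

/-- Defining relations of the braid group `B_n` (zero-based generators). -/
def braidRels (n : ℕ) : Set (FreeGroup (Fin (n - 1))) :=
  { r | (∃ i j : Fin (n - 1), (i : ℕ) + 2 ≤ (j : ℕ) ∧
          r = FreeGroup.of i * FreeGroup.of j * (FreeGroup.of i)⁻¹ * (FreeGroup.of j)⁻¹) ∨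
        (∃ i j : Fin (n - 1), (j : ℕ) = (i : ℕ) + 1 ∧
          r = FreeGroup.of i * FreeGroup.of j * FreeGroup.of i *
              (FreeGroup.of j * FreeGroup.of i * FreeGroup.of j)⁻¹) }

/-- The braid group `B_n` as a presented group. -/
abbrev BraidGroup (n : ℕ) := PresentedGroup (braidRels n)

/-- Lexicographic identification of `(Fin 3 → Fin 2)` with `Fin 8`. -/
def emb (v : Fin 3 → Fin 2) : Fin 8 :=
  ⟨4 * (v 0 : ℕ) + 2 * (v 1 : ℕ) + (v 2 : ℕ), by
    have := (v 0).isLt; have := (v 1).isLt; have := (v 2).isLt; omega⟩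

/-- View an `8×8` matrix as an endomorphism of `(ℂ²)^{⊗3}` via the
lexicographically ordered basis. -/
def ofMat8 (M : Matrix (Fin 8) (Fin 8) ℂ) : MIM 2 3 :=
  fun a b => M (emb a) (emb b)

/-- The `(2,3,1)` operator of type I. -/
noncomputable def RI (θ : ℝ) : MIM 2 3 :=
  ofMat8 <| ((Real.sqrt 2 : ℂ))⁻¹ •
    (Matrix.reindex finSumFinEquiv finSumFinEquiv <| Matrix.fromBlocks
      !![1, 0, 1, 0;
         0, Complex.I, 0, Complex.exp (θ * Complex.I);
         -Complex.I, 0, Complex.I, 0;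
         0, -Complex.I * Complex.exp (-θ * Complex.I), 0, 1] 0 0
      !![Complex.I, 0, Complex.exp (θ * Complex.I), 0;
         0, 1, 0, -Complex.exp (2 * θ * Complex.I);
         -Complex.I * Complex.exp (-θ * Complex.I), 0, 1, 0;
         0, Complex.I * Complex.exp (-2 * θ * Complex.I), 0, Complex.I])

/-- The `(2,3,1)` operator of type II. -/
noncomputable def RII (θ : ℝ) : MIM 2 3 :=
  ofMat8 <| ((Real.sqrt 2 : ℂ))⁻¹ •
    (Matrix.reindex finSumFinEquiv finSumFinEquiv <| Matrix.fromBlocks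
      !![1, 0, 1, 0;
         0, Complex.I, 0, Complex.exp (θ * Complex.I);
         -1, 0, 1, 0;
         0, Complex.exp (-θ * Complex.I), 0, Complex.I] 0 0
      !![Complex.I, 0, Complex.exp (θ * Complex.I), 0;
         0, 1, 0, -Complex.exp (2 * θ * Complex.I);
         Complex.exp (-θ * Complex.I), 0, Complex.I, 0;
         0, Complex.exp (-2 * θ * Complex.I), 0, 1])

/-- The `(2,3,1)` operator of type III. -/
noncomputable def RIII (θ : ℝ) : MIM 2 3 :=
  ofMat8 <| ((Real.sqrt 2 : ℂ))⁻¹ •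
    (Matrix.reindex finSumFinEquiv finSumFinEquiv <| Matrix.fromBlocks
      !![1, 0, 1, 0;
         0, 1, 0, Complex.exp (θ * Complex.I);
         -1, 0, 1, 0;
         0, -Complex.exp (-θ * Complex.I), 0, 1] 0 0
      !![1, 0, -Complex.exp (θ * Complex.I), 0;
         0, 1, 0, -Complex.exp (2 * θ * Complex.I);
         Complex.exp (-θ * Complex.I), 0, 1, 0;
         0, Complex.exp (-2 * θ * Complex.I), 0, 1])

/-- The `4×4` antidiagonal matrix `J`. -/
def Jmat : Matrix (Fin 4) (Fin 4) ℂ :=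
  !![0, 0, 0, 1;
     0, 0, 1, 0;
     0, 1, 0, 0;
     1, 0, 0, 0]

/-- The `(2,3,2)` operator of Rowell–Zhang–Wu–Ge. -/
noncomputable def R232 : MIM 2 3 :=
  ofMat8 <| ((Real.sqrt 2 : ℂ))⁻¹ •
    (Matrix.reindex finSumFinEquiv finSumFinEquiv <|
      Matrix.fromBlocks 1 Jmat (-Jmat) 1)

/-- The operator on `V^{⊗N}` changing only the tensor factor `p`, with amplitude `f a s` between
the basis vector `a` and the one whose factor `p` is `s`. -/
def siteOp {ι κ : Type*} [Fintype ι] [DecidableEq ι] [DecidableEq κ] (p : ι)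
    (f : (ι → κ) → κ → ℂ) : Matrix (ι → κ) (ι → κ) ℂ :=
  fun a b => if ∀ x, x ≠ p → a x = b x then f a (b p) else 0

section siteOp

variable {ι κ : Type*} [Fintype ι] [DecidableEq ι] [DecidableEq κ]

theorem siteOp_update (p : ι) (f : (ι → κ) → κ → ℂ) (a : ι → κ) (s : κ) :
    siteOp p f a (Function.update a p s) = f a s := by
  simp +contextual [siteOp]

variable [Fintype κ]

theorem siteOp_mul_apply {β : Type*} (p : ι) (f : (ι → κ) → κ → ℂ) (X : Matrix (ι → κ) β ℂ)
    (a : ι → κ) (b : β) :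
    (siteOp p f * X) a b = ∑ s, f a s * X (Function.update a p s) b := by
  rw [Matrix.mul_apply]
  symm
  refine Finset.sum_of_injOn (Function.update a p) ?_ (by simp) ?_ ?_
  · exact (Function.update_injective a p).injOn
  · intro c _ hc
    have : ¬ ∀ x, x ≠ p → a x = c x := by
      intro h
      refine hc ⟨c p, by simp, ?_⟩
      ext x
      by_cases hx : x = p
      · subst hx; simp
      · simp [hx, h x hx]
    simp [siteOp, this]
  · intro s _
    rw [siteOp_update]

theorem siteOp_mul_siteOp_apply {p q : ι} (hpq : p ≠ q) (f g : (ι → κ) → κ → ℂ)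
    (hg : ∀ a s t, g (Function.update a p s) t = g a t) (a b : ι → κ) :
    (siteOp p f * siteOp q g) a b =
      if ∀ x, x ≠ p → x ≠ q → a x = b x then f a (b p) * g a (b q) else 0 := by
  rw [siteOp_mul_apply, Finset.sum_eq_single (b p)]
  · rw [siteOp, hg, mul_ite, mul_zero]
    congr 1
    refine propext ⟨fun h x hp hq => by simpa [hp] using h x hq, fun h x hq => ?_⟩
    by_cases hp : x = p
    · subst hp; simp
    · simpa [hp] using h x hp hq
  · intro s _ hs
    have : ¬ ∀ x, x ≠ q → Function.update a p s x = b x := fun h => hs (by simpa using h p hpq)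
    simp [siteOp, this]
  · simp

theorem siteOp_mul_siteOp_mul_siteOp_apply {p q : ι} (hpq : p ≠ q)
    (f g h : (ι → κ) → κ → ℂ) (a b : ι → κ) :
    (siteOp p f * (siteOp q g * siteOp p h)) a b =
      if ∀ x, x ≠ p → x ≠ q → a x = b x then
        ∑ s, f a s * (g (Function.update a p s) (b q) *
          h (Function.update (Function.update a p s) q (b q)) (b p))
      else 0 := by
  have inner (s : κ) : (siteOp q g * siteOp p h) (Function.update a p s) b =
      if ∀ x, x ≠ p → x ≠ q → a x = b x then
        g (Function.update a p s) (b q) *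
          h (Function.update (Function.update a p s) q (b q)) (b p)
      else 0 := by
    rw [siteOp_mul_apply, Finset.sum_eq_single (b q)]
    · rw [siteOp, mul_ite, mul_zero]
      congr 1
      refine propext ⟨fun h x hp hq => by simpa [hp, hq] using h x hp, fun h x hp => ?_⟩
      by_cases hq : x = q
      · subst hq; simp
      · simpa [hp, hq] using h x hp hq
    · intro t _ ht
      have : ¬ ∀ x, x ≠ p → Function.update (Function.update a p s) q t x = b x :=
        fun h => ht (by simpa using h q hpq.symm)
      simp [siteOp, this]
    · simp
  rw [siteOp_mul_apply]
  simp only [inner, mul_ite, mul_zero]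
  split_ifs <;> simp

theorem siteOp_commute {p q : ι} (hpq : p ≠ q) (f g : (ι → κ) → κ → ℂ)
    (hf : ∀ a s t, f (Function.update a q s) t = f a t)
    (hg : ∀ a s t, g (Function.update a p s) t = g a t) :
    siteOp p f * siteOp q g = siteOp q g * siteOp p f := by
  ext a b
  rw [siteOp_mul_siteOp_apply hpq f g hg, siteOp_mul_siteOp_apply hpq.symm g f hf,
    mul_comm (f a (b p))]
  congr 1
  exact propext ⟨fun h x hq hp => h x hp hq, fun h x hp hq => h x hq hp⟩

end siteOp

/-- The `2×2` matrices, up to the factor `1/√2`, by which `RII` acts on the middle tensor factor,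
controlled by the two outer ones; here `u = e^{iθ}` and `v = e^{-iθ}`. -/
noncomputable def middle (u v : ℂ) : Fin 2 → Fin 2 → Matrix (Fin 2) (Fin 2) ℂ :=
  ![![!![1, 1; -1, 1], !![Complex.I, u; v, Complex.I]],
    ![!![Complex.I, u; v, Complex.I], !![1, -u ^ 2; v ^ 2, 1]]]

/-- The amplitude `⟨i s k| RII |i t k⟩`. -/
noncomputable def amp (θ : ℝ) (i k s t : Fin 2) : ℂ :=
  (Real.sqrt 2 : ℂ)⁻¹ *
    middle (Complex.exp (θ * Complex.I)) (Complex.exp (-θ * Complex.I)) i k s t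

theorem finSumFinEquiv_symm_emb (i j k : Fin 2) :
    (finSumFinEquiv (m := 4) (n := 4)).symm (emb ![i, j, k]) =
      if i = 0 then Sum.inl ⟨2 * j + k, by omega⟩ else Sum.inr ⟨2 * j + k, by omega⟩ := by
  decide +revert

theorem RII_apply (θ : ℝ) (a b : Fin 3 → Fin 2) :
    RII θ a b = if a 0 = b 0 ∧ a 2 = b 2 then amp θ (a 0) (a 2) (a 1) (b 1) else 0 := by
  have h2 : Complex.exp (2 * θ * Complex.I) = Complex.exp (θ * Complex.I) ^ 2 := by
    rw [← Complex.exp_nat_mul]; congr 1; push_cast; ring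
  have h3 : Complex.exp (-2 * θ * Complex.I) = Complex.exp (-θ * Complex.I) ^ 2 := by
    rw [← Complex.exp_nat_mul]; congr 1; push_cast; ring
  have key (i j k i' j' k' : Fin 2) : RII θ ![i, j, k] ![i', j', k'] =
      if i = i' ∧ k = k' then amp θ i k j j' else 0 := by
    simp only [RII, ofMat8, Matrix.smul_apply, Matrix.reindex_apply, Matrix.submatrix_apply,
      finSumFinEquiv_symm_emb, h2, h3, amp, smul_eq_mul]
    fin_cases i <;> fin_cases i' <;> fin_cases j <;> fin_cases j' <;> fin_cases k <;>
      fin_cases k' <;> simp [middle]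
  have ha : a = ![a 0, a 1, a 2] := by ext x; fin_cases x <;> rfl
  have hb : b = ![b 0, b 1, b 2] := by ext x; fin_cases x <;> rfl
  rw [← key, ← ha, ← hb]

theorem exp_mul_exp_neg (θ : ℝ) :
    Complex.exp (θ * Complex.I) * Complex.exp (-θ * Complex.I) = 1 := by
  rw [← Complex.exp_add]; simp

theorem sum_amp_mul_star_amp (θ : ℝ) (i k s t : Fin 2) :
    ∑ r, amp θ i k s r * star (amp θ i k t r) = if s = t then 1 else 0 := by
  have hu : (starRingEnd ℂ) (Complex.exp (θ * Complex.I)) = Complex.exp (-θ * Complex.I) := by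
    rw [← Complex.exp_conj]; simp
  have hv : (starRingEnd ℂ) (Complex.exp (-θ * Complex.I)) = Complex.exp (θ * Complex.I) := by
    rw [← Complex.exp_conj]; simp
  have hc : (Real.sqrt 2 : ℂ)⁻¹ ^ 2 = 1 / 2 := by
    rw [inv_pow, ← Complex.ofReal_pow, Real.sq_sqrt (by norm_num)]; norm_num
  have huv := exp_mul_exp_neg θ
  have hI := Complex.I_sq
  simp only [amp, star_mul', Complex.star_def, map_inv₀, Complex.conj_ofReal, Fin.sum_univ_two]
  generalize Complex.exp (θ * Complex.I) = u at *
  generalize Complex.exp (-θ * Complex.I) = v at *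
  generalize (Real.sqrt 2 : ℂ)⁻¹ = c at *
  fin_cases i <;> fin_cases k <;> fin_cases s <;> fin_cases t <;>
    simp [middle, hu, hv] <;> grind

theorem amp_yangBaxter (θ : ℝ) (i j k l j' k' : Fin 2) :
    ∑ s, amp θ i k j s * (amp θ s l k k' * amp θ i k' s j') =
      ∑ t, amp θ j l k t * (amp θ i t j j' * amp θ j' l t k') := by
  have huv := exp_mul_exp_neg θ
  have hI := Complex.I_sq
  simp only [amp, Fin.sum_univ_two]
  generalize Complex.exp (θ * Complex.I) = u at *
  generalize Complex.exp (-θ * Complex.I) = v at *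
  generalize (Real.sqrt 2 : ℂ)⁻¹ = c at *
  fin_cases i <;> fin_cases j <;> fin_cases k <;> fin_cases l <;> fin_cases j' <;>
    fin_cases k' <;> simp [middle] <;> grind

theorem RII_eq_siteOp (θ : ℝ) : RII θ = siteOp 1 fun a s => amp θ (a 0) (a 2) (a 1) s := by
  ext a b
  simp [RII_apply, siteOp, Fin.forall_fin_succ]

theorem RII_mul_star (θ : ℝ) : RII θ * star (RII θ) = 1 := by
  ext a b
  have hab : a = b ↔ (a 0 = b 0 ∧ a 2 = b 2) ∧ a 1 = b 1 := by
    simp [funext_iff, Fin.forall_fin_succ]; tauto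
  nth_rewrite 1 [RII_eq_siteOp]
  simp only [siteOp_mul_apply, Matrix.star_apply, RII_apply, Matrix.one_apply, hab]
  by_cases h : a 0 = b 0 ∧ a 2 = b 2
  · simpa [h, h.1, h.2] using sum_amp_mul_star_amp θ (b 0) (b 2) (a 1) (b 1)
  · have h' : ¬ (b 0 = a 0 ∧ b 2 = a 2) := fun h' => h ⟨h'.1.symm, h'.2.symm⟩
    simp [h, h']

theorem Rop_RII (θ : ℝ) (n : ℕ) (i : Fin (n - 1)) :
    Rop 2 3 1 n (RII θ) i = siteOp ⟨i + 1, by omega⟩ fun a s =>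
      amp θ (a ⟨i, by omega⟩) (a ⟨i + 2, by omega⟩) (a ⟨i + 1, by omega⟩) s := by
  ext a b
  simp only [Rop, RII_apply, siteOp, one_mul, Fin.val_zero, Fin.val_one, Fin.val_two, add_zero]
  rw [← ite_and]
  congr 1
  refine propext ⟨fun ⟨h, h0, h2⟩ x hx => ?_, fun h => ⟨fun x hx => h x ?_, h _ ?_, h _ ?_⟩⟩
  · by_cases hx0 : (x : ℕ) = i
    · rw [show x = ⟨i, by omega⟩ from Fin.ext hx0]
      exact h0
    by_cases hx2 : (x : ℕ) = i + 2
    · rw [show x = ⟨i + 2, by omega⟩ from Fin.ext hx2]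
      exact h2
    rw [ne_eq, Fin.ext_iff] at hx
    exact h x (by simp only at hx; omega)
  all_goals simp only [ne_eq, Fin.ext_iff]; omega

theorem Rop_RII_braid (θ : ℝ) :
    Rop 2 3 1 3 (RII θ) 0 * Rop 2 3 1 3 (RII θ) 1 * Rop 2 3 1 3 (RII θ) 0 =
      Rop 2 3 1 3 (RII θ) 1 * Rop 2 3 1 3 (RII θ) 0 * Rop 2 3 1 3 (RII θ) 1 := by
  have h0 : Rop 2 3 1 3 (RII θ) 0 = siteOp (ι := Fin 4) 1 fun a s =>
      amp θ (a 0) (a 2) (a 1) s := Rop_RII θ 3 0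
  have h1 : Rop 2 3 1 3 (RII θ) 1 = siteOp (ι := Fin 4) 2 fun a s =>
      amp θ (a 1) (a 3) (a 2) s := Rop_RII θ 3 1
  rw [h0, h1]
  ext a b
  rw [mul_assoc, mul_assoc, siteOp_mul_siteOp_mul_siteOp_apply (by decide),
    siteOp_mul_siteOp_mul_siteOp_apply (by decide)]
  congr 1
  · exact propext ⟨fun h x hp hq => h x hq hp, fun h x hp hq => h x hq hp⟩
  · simpa [Function.update_apply] using
      amp_yangBaxter θ (a 0) (a 1) (a 2) (a 3) (b 1) (b 2)

theorem Rop_RII_far_commute (θ : ℝ) (j : ℕ) (hj : 4 ≤ j) :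
    Rop 2 3 1 j (RII θ) ⟨0, by omega⟩ * Rop 2 3 1 j (RII θ) ⟨j - 2, by omega⟩ =
      Rop 2 3 1 j (RII θ) ⟨j - 2, by omega⟩ * Rop 2 3 1 j (RII θ) ⟨0, by omega⟩ := by
  rw [Rop_RII, Rop_RII]
  apply siteOp_commute
  · simp only [ne_eq, Fin.ext_iff]; omega
  all_goals
    intro a s t
    congr 1 <;> refine Function.update_of_ne ?_ _ _ <;> simp only [ne_eq, Fin.ext_iff] <;> omega

theorem stmt12 (θ : ℝ) :
    RII θ ∈ Matrix.unitaryGroup (Fin 3 → Fin 2) ℂ ∧ IsGYB 2 3 1 (RII θ) := by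
  have hU : RII θ ∈ Matrix.unitaryGroup (Fin 3 → Fin 2) ℂ :=
    Matrix.mem_unitaryGroup_iff.2 (RII_mul_star θ)
  exact ⟨hU, IsUnit.of_mul_eq_one _ (RII_mul_star θ), Rop_RII_braid θ, Rop_RII_far_commute θ⟩
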